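/- Assume q^{2l} = 1 where l ≥ 2 is the smallest positive integer with this property. Let A₊ be the unital ℂ-subalgebra of B generated by C, C'₂, X₊^l and (C−λX₀)^l, and let A₋ be the unital ℂ-subalgebra generated by C, C'₂, X₋^l and (C−λX₀)^l. Then the centre of B equals the ℂ-subspace A₊ + A₋. -/

import Mathlib

noncomputable section

namespace SL2q

/-- The free algebra on the four generators X₀, X₊, X₋, C. -/
abbrev Free := FreeAlgebra ℂ (Fin 4)

def gX0 : Free := FreeAlgebra.ι ℂ 0
def gXp : Free := FreeAlgebra.ι ℂ 1
def gXm : Free := FreeAlgebra.ι ℂ 2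
def gC  : Free := FreeAlgebra.ι ℂ 3

/-- The defining relations of the algebra B of Lyubashenko–Sudbery. -/
inductive Rel (q : ℂ) : Free → Free → Prop
  | r1  : Rel q ((q ^ 2) • (gX0 * gXp) - gXp * gX0) (q • (gC * gXp))
  | r2  : Rel q ((q⁻¹ ^ 2) • (gX0 * gXm) - gXm * gX0) (-(q⁻¹ • (gC * gXm)))
  | r3  : Rel q (gXp * gXm - gXm * gXp)
      ((q + q⁻¹) • ((gC - (q - q⁻¹) • gX0) * gX0))
  | rc0 : Rel q (gC * gX0) (gX0 * gC)
  | rcp : Rel q (gC * gXp) (gXp * gC)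
  | rcm : Rel q (gC * gXm) (gXm * gC)

/-- The algebra B, presented by generators and relations. -/
abbrev B (q : ℂ) := RingQuot (Rel q)

def X0 (q : ℂ) : B q := RingQuot.mkAlgHom ℂ (Rel q) gX0
def Xp (q : ℂ) : B q := RingQuot.mkAlgHom ℂ (Rel q) gXp
def Xm (q : ℂ) : B q := RingQuot.mkAlgHom ℂ (Rel q) gXm
def Cc (q : ℂ) : B q := RingQuot.mkAlgHom ℂ (Rel q) gC

/-- C'₂ = X₋X₊ + q⁻¹ C X₀ + q⁻² X₀². -/
def C2 (q : ℂ) : B q :=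
  Xm q * Xp q + q⁻¹ • (Cc q * X0 q) + (q⁻¹ ^ 2) • (X0 q) ^ 2

section Relations

variable (q : ℂ)

/-- The element `C - λ X₀`, which `q²`-commutes with `X₊` and `X₋`. -/
def Kk : B q := Cc q - (q - q⁻¹) • X0 q

theorem X0_mul_Xp : (q ^ 2) • (X0 q * Xp q) - Xp q * X0 q = q • (Cc q * Xp q) := by
  simpa [X0, Xp, Cc] using RingQuot.mkAlgHom_rel ℂ (Rel.r1 (q := q))

theorem X0_mul_Xm :
    (q⁻¹ ^ 2) • (X0 q * Xm q) - Xm q * X0 q = -(q⁻¹ • (Cc q * Xm q)) := by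
  simpa [X0, Xm, Cc] using RingQuot.mkAlgHom_rel ℂ (Rel.r2 (q := q))

theorem Xp_mul_Xm_sub : Xp q * Xm q - Xm q * Xp q =
    (q + q⁻¹) • ((Cc q - (q - q⁻¹) • X0 q) * X0 q) := by
  have h := RingQuot.mkAlgHom_rel ℂ (Rel.r3 (q := q))
  simp only [map_sub, map_mul, map_smul] at h
  exact h

theorem commute_Cc_X0 : Commute (Cc q) (X0 q) := by
  show _ = _
  simpa [X0, Cc] using RingQuot.mkAlgHom_rel ℂ (Rel.rc0 (q := q))

theorem commute_Cc_Xp : Commute (Cc q) (Xp q) := by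
  show _ = _
  simpa [Xp, Cc] using RingQuot.mkAlgHom_rel ℂ (Rel.rcp (q := q))

theorem commute_Cc_Xm : Commute (Cc q) (Xm q) := by
  show _ = _
  simpa [Xm, Cc] using RingQuot.mkAlgHom_rel ℂ (Rel.rcm (q := q))

theorem commute_Cc_Kk : Commute (Cc q) (Kk q) :=
  (Commute.refl _).sub_right ((commute_Cc_X0 q).smul_right _)

/-- The generators generate `B`. -/
theorem eq_top_of_generators_mem (S : Subalgebra ℂ (B q)) (h0 : X0 q ∈ S) (hp : Xp q ∈ S)
    (hm : Xm q ∈ S) (hc : Cc q ∈ S) (x : B q) : x ∈ S := by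
  obtain ⟨y, rfl⟩ := RingQuot.mkAlgHom_surjective ℂ (Rel q) x
  induction y using FreeAlgebra.induction with
  | grade0 r => rw [AlgHom.commutes]; exact S.algebraMap_mem r
  | grade1 i => fin_cases i <;> assumption
  | mul a b ha hb => rw [map_mul]; exact S.mul_mem ha hb
  | add a b ha hb => rw [map_add]; exact S.add_mem ha hb

theorem mem_center_of_commute {y : B q} (h0 : Commute y (X0 q)) (hp : Commute y (Xp q))
    (hm : Commute y (Xm q)) (hc : Commute y (Cc q)) :
    y ∈ Subalgebra.center ℂ (B q) := by
  rw [Subalgebra.mem_center_iff]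
  intro x
  have := eq_top_of_generators_mem q (Subalgebra.centralizer ℂ {y})
    (by simpa [Subalgebra.mem_centralizer_iff] using h0.eq)
    (by simpa [Subalgebra.mem_centralizer_iff] using hp.eq)
    (by simpa [Subalgebra.mem_centralizer_iff] using hm.eq)
    (by simpa [Subalgebra.mem_centralizer_iff] using hc.eq) x
  simpa [Subalgebra.mem_centralizer_iff, eq_comm] using this

variable {q}

theorem sub_inv_ne_zero (hq : q ≠ 0) (hq2 : q ^ 2 ≠ 1) : q - q⁻¹ ≠ 0 := by
  intro h
  apply hq2
  field_simp at h
  linear_combination h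

theorem X0_eq (hq : q ≠ 0) (hq2 : q ^ 2 ≠ 1) : X0 q = (q - q⁻¹)⁻¹ • (Cc q - Kk q) := by
  simp [Kk, smul_smul, inv_mul_cancel₀ (sub_inv_ne_zero hq hq2)]

theorem Xp_mul_X0 : Xp q * X0 q = (q ^ 2) • (X0 q * Xp q) - q • (Cc q * Xp q) := by
  rw [← X0_mul_Xp]; abel

theorem Xm_mul_X0 : Xm q * X0 q = (q⁻¹ ^ 2) • (X0 q * Xm q) + q⁻¹ • (Cc q * Xm q) := by
  rw [← neg_eq_iff_eq_neg.mpr (X0_mul_Xm q)]; abel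

theorem Xp_mul_Kk (hq : q ≠ 0) : Xp q * Kk q = (q ^ 2) • (Kk q * Xp q) := by
  simp only [Kk, mul_sub, sub_mul, mul_smul_comm, smul_mul_assoc, Xp_mul_X0,
    ← (commute_Cc_Xp q).eq]
  match_scalars <;> field_simp <;> ring

theorem Xm_mul_Kk (hq : q ≠ 0) : Xm q * Kk q = ((q ^ 2)⁻¹) • (Kk q * Xm q) := by
  simp only [Kk, mul_sub, sub_mul, mul_smul_comm, smul_mul_assoc, Xm_mul_X0,
    ← (commute_Cc_Xm q).eq]
  match_scalars <;> field_simp <;> ring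

theorem commute_Cc_C2 : Commute (Cc q) (C2 q) :=
  ((((commute_Cc_Xm q).mul_right (commute_Cc_Xp q)).add_right
    (((Commute.refl _).mul_right (commute_Cc_X0 q)).smul_right _)).add_right
    (((commute_Cc_X0 q).pow_right 2).smul_right _))

theorem Xm_mul_Xp : Xm q * Xp q = C2 q - q⁻¹ • (Cc q * X0 q) - (q⁻¹ ^ 2) • (X0 q) ^ 2 := by
  rw [C2]; abel

theorem Xp_mul_Xm (hq : q ≠ 0) :
    Xp q * Xm q = C2 q + q • (Cc q * X0 q) - (q ^ 2) • (X0 q) ^ 2 := by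
  rw [sub_eq_iff_eq_add.mp (Xp_mul_Xm_sub q), C2]
  simp only [sub_mul, smul_mul_assoc, pow_two (X0 q)]
  match_scalars <;> field_simp <;> ring

theorem commute_X0_C2 (hq : q ≠ 0) : Commute (X0 q) (C2 q) := by
  have h : Commute (X0 q) (Xm q * Xp q) := by
    have h1 : Xm q * Xp q * X0 q = X0 q * (Xm q * Xp q) := by
      rw [mul_assoc, Xp_mul_X0, mul_sub, mul_smul_comm, mul_smul_comm, ← mul_assoc, Xm_mul_X0,
        ← mul_assoc (Xm q) (Cc q), ← (commute_Cc_Xm q).eq]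
      simp only [add_mul, smul_mul_assoc, mul_assoc]
      match_scalars <;> field_simp <;> ring
    exact h1.symm
  exact (h.add_right (((commute_Cc_X0 q).symm.mul_right (Commute.refl _)).smul_right _)).add_right
    (((Commute.refl _).pow_right 2).smul_right _)

theorem commute_Xp_C2 (hq : q ≠ 0) : Commute (Xp q) (C2 q) := by
  have h : Xp q * C2 q = Xp q * Xm q * Xp q +
      Xp q * (q⁻¹ • (Cc q * X0 q) + (q⁻¹ ^ 2) • X0 q ^ 2) := by
    rw [C2, add_assoc, mul_add, mul_assoc]
  have e1 : Xp q * (Cc q * X0 q) = Cc q * (Xp q * X0 q) := by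
    rw [← mul_assoc, ← (commute_Cc_Xp q).eq, mul_assoc]
  have e2 : X0 q * (Cc q * Xp q) = Cc q * (X0 q * Xp q) := by
    rw [← mul_assoc, ← (commute_Cc_X0 q).eq, mul_assoc]
  have e3 : Xp q * (X0 q * X0 q) = (q ^ 4) • (X0 q * (X0 q * Xp q))
      - (2 * q ^ 3) • (Cc q * (X0 q * Xp q)) + q ^ 2 • (Cc q * (Cc q * Xp q)) := by
    rw [← mul_assoc, Xp_mul_X0, sub_mul, smul_mul_assoc, smul_mul_assoc, mul_assoc, mul_assoc,
      Xp_mul_X0]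
    simp only [mul_sub, mul_smul_comm, e2]
    match_scalars <;> field_simp <;> ring
  rw [Commute, SemiconjBy, h, Xp_mul_Xm hq]
  simp only [mul_add, mul_smul_comm, sub_mul, add_mul, smul_mul_assoc, e1, Xp_mul_X0, mul_sub,
    pow_two (X0 q), e3, mul_assoc]
  match_scalars <;> field_simp <;> ring

theorem commute_Xm_C2 (hq : q ≠ 0) : Commute (Xm q) (C2 q) := by
  have e1 : Xm q * (Cc q * X0 q) = Cc q * (Xm q * X0 q) := by
    rw [← mul_assoc, ← (commute_Cc_Xm q).eq, mul_assoc]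
  have e2 : X0 q * (Cc q * Xm q) = Cc q * (X0 q * Xm q) := by
    rw [← mul_assoc, ← (commute_Cc_X0 q).eq, mul_assoc]
  have e3 : Xm q * (X0 q * X0 q) = (q⁻¹ ^ 4) • (X0 q * (X0 q * Xm q))
      + (2 * q⁻¹ ^ 3) • (Cc q * (X0 q * Xm q)) + q⁻¹ ^ 2 • (Cc q * (Cc q * Xm q)) := by
    rw [← mul_assoc, Xm_mul_X0, add_mul, smul_mul_assoc, smul_mul_assoc, mul_assoc, mul_assoc,
      Xm_mul_X0]
    simp only [mul_add, mul_smul_comm, e2]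
    match_scalars <;> field_simp <;> ring
  have h : C2 q = Xp q * Xm q + ((-q) • (Cc q * X0 q) + (q ^ 2) • (X0 q) ^ 2) := by
    rw [Xp_mul_Xm hq]; module
  have h2 : Xm q * C2 q = Xm q * Xp q * Xm q +
      Xm q * ((-q) • (Cc q * X0 q) + (q ^ 2) • X0 q ^ 2) := by
    rw [h, mul_add, mul_assoc]
  rw [Commute, SemiconjBy, h2, Xm_mul_Xp]
  simp only [mul_add, mul_smul_comm, sub_mul, smul_mul_assoc, e1, Xm_mul_X0,
    pow_two (X0 q), e3, mul_assoc]
  match_scalars <;> field_simp <;> ring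

theorem commute_Kk_C2 (hq : q ≠ 0) : Commute (Kk q) (C2 q) :=
  commute_Cc_C2.sub_left ((commute_X0_C2 hq).smul_left _)

theorem C2_mem_center (hq : q ≠ 0) : C2 q ∈ Subalgebra.center ℂ (B q) :=
  mem_center_of_commute q (commute_X0_C2 hq).symm (commute_Xp_C2 hq).symm
    (commute_Xm_C2 hq).symm commute_Cc_C2.symm

theorem Cc_mem_center : Cc q ∈ Subalgebra.center ℂ (B q) :=
  mem_center_of_commute q (commute_Cc_X0 q) (commute_Cc_Xp q) (commute_Cc_Xm q) (Commute.refl _)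

/-- The quadratic polynomial in `s K` through which `X₋X₊` (`s = 1`) and `X₊X₋` (`s = q²`)
are expressed. -/
def quadK (q s : ℂ) : B q :=
  C2 q - ((q - q⁻¹)⁻¹ ^ 2) • (Cc q ^ 2 - ((1 + (q ^ 2)⁻¹) * s) • (Cc q * Kk q)
    + ((q ^ 2)⁻¹ * s ^ 2) • Kk q ^ 2)

theorem sq_Cc_sub_Kk :
    (Cc q - Kk q) ^ 2 = Cc q ^ 2 - (2 : ℂ) • (Cc q * Kk q) + Kk q ^ 2 := by
  rw [pow_two, mul_sub, sub_mul, sub_mul, ← (commute_Cc_Kk q).eq, pow_two, pow_two]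
  module

theorem Xm_mul_Xp_eq_quadK (hq : q ≠ 0) (hq2 : q ^ 2 ≠ 1) : Xm q * Xp q = quadK q 1 := by
  have hl := sub_inv_ne_zero hq hq2
  have hl' : q ^ 2 - 1 ≠ 0 := sub_ne_zero.mpr hq2
  rw [Xm_mul_Xp, X0_eq hq hq2, quadK, smul_pow, sq_Cc_sub_Kk, mul_smul_comm, mul_sub, ← pow_two]
  match_scalars <;> field_simp <;> ring

theorem Xp_mul_Xm_eq_quadK (hq : q ≠ 0) (hq2 : q ^ 2 ≠ 1) : Xp q * Xm q = quadK q (q ^ 2) := by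
  have hl := sub_inv_ne_zero hq hq2
  have hl' : q ^ 2 - 1 ≠ 0 := sub_ne_zero.mpr hq2
  rw [Xp_mul_Xm hq, X0_eq hq hq2, quadK, smul_pow, sq_Cc_sub_Kk, mul_smul_comm, mul_sub, ← pow_two]
  match_scalars <;> field_simp <;> ring

theorem mul_pow_Kk {y : B q} {t : ℂ} (h : y * Kk q = t • (Kk q * y)) (n : ℕ) :
    y * Kk q ^ n = t ^ n • (Kk q ^ n * y) := by
  induction n with
  | zero => simp
  | succ n ih =>
    rw [pow_succ, ← mul_assoc, ih, smul_mul_assoc, mul_assoc, h, mul_smul_comm, smul_smul,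
      ← mul_assoc, pow_succ]

theorem pow_mul_Kk {y : B q} {t : ℂ} (h : y * Kk q = t • (Kk q * y)) (n : ℕ) :
    y ^ n * Kk q = t ^ n • (Kk q * y ^ n) := by
  induction n with
  | zero => simp
  | succ n ih =>
    rw [pow_succ, mul_assoc, h, mul_smul_comm, ← mul_assoc, ih, smul_mul_assoc, smul_smul,
      mul_assoc, pow_succ' t]

theorem mul_quadK (hq : q ≠ 0) {y : B q} {t : ℂ} (h : y * Kk q = t • (Kk q * y)) (s : ℂ) :
    y * quadK q s = quadK q (t * s) * y := by
  have h2 : y * C2 q = C2 q * y := Subalgebra.mem_center_iff.mp (C2_mem_center hq) y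
  have hc : y * Cc q = Cc q * y := Subalgebra.mem_center_iff.mp Cc_mem_center y
  have hc2 : y * Cc q ^ 2 = Cc q ^ 2 * y := (show Commute y (Cc q) from hc).pow_right 2
  have hck : y * (Cc q * Kk q) = t • (Cc q * Kk q * y) := by
    rw [← mul_assoc, hc, mul_assoc, h, mul_smul_comm, mul_assoc]
  simp only [quadK, mul_sub, sub_mul, mul_add, add_mul, mul_smul_comm, smul_mul_assoc, h2, hc2,
    hck, mul_pow_Kk h]
  module

theorem commute_Xm_pow_Xp (hq : q ≠ 0) (hq2 : q ^ 2 ≠ 1) {l : ℕ} (hl : (q ^ 2) ^ l = 1) :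
    Commute (Xm q ^ l) (Xp q) := by
  cases l with
  | zero => simp
  | succ k =>
    have ht : ((q ^ 2)⁻¹) ^ k * 1 = q ^ 2 := by
      rw [mul_one, inv_pow]
      exact inv_eq_of_mul_eq_one_right (by rw [← pow_succ, hl])
    rw [Commute, SemiconjBy]
    nth_rw 1 [pow_succ]
    rw [mul_assoc, Xm_mul_Xp_eq_quadK hq hq2, mul_quadK hq (pow_mul_Kk (Xm_mul_Kk hq) k),
      ht, pow_succ' (Xm q), ← mul_assoc, Xp_mul_Xm_eq_quadK hq hq2]

theorem commute_Xp_pow_Xm (hq : q ≠ 0) (hq2 : q ^ 2 ≠ 1) {l : ℕ} (hl : (q ^ 2) ^ l = 1) :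
    Commute (Xp q ^ l) (Xm q) := by
  cases l with
  | zero => simp
  | succ k =>
    rw [Commute, SemiconjBy]
    nth_rw 1 [pow_succ]
    rw [mul_assoc, Xp_mul_Xm_eq_quadK hq hq2, mul_quadK hq (pow_mul_Kk (Xp_mul_Kk hq) k),
      ← pow_succ, hl, pow_succ' (Xp q), ← mul_assoc, Xm_mul_Xp_eq_quadK hq hq2]

theorem commute_X0_of_commute_Kk (hq : q ≠ 0) (hq2 : q ^ 2 ≠ 1) {y : B q}
    (hK : Commute y (Kk q)) : Commute y (X0 q) := by
  rw [X0_eq hq hq2]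
  have hc : Commute y (Cc q) := Subalgebra.mem_center_iff.mp Cc_mem_center y
  exact (hc.sub_right hK).smul_right _

theorem Xp_pow_mem_center (hq : q ≠ 0) (hq2 : q ^ 2 ≠ 1) {l : ℕ} (hl : (q ^ 2) ^ l = 1) :
    Xp q ^ l ∈ Subalgebra.center ℂ (B q) := by
  refine mem_center_of_commute q (commute_X0_of_commute_Kk hq hq2 ?_)
    ((Commute.refl _).pow_left l) (commute_Xp_pow_Xm hq hq2 hl)
    ((commute_Cc_Xp q).symm.pow_left l)
  show _ = _
  simpa [hl] using pow_mul_Kk (Xp_mul_Kk hq) l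

theorem Xm_pow_mem_center (hq : q ≠ 0) (hq2 : q ^ 2 ≠ 1) {l : ℕ} (hl : (q ^ 2) ^ l = 1) :
    Xm q ^ l ∈ Subalgebra.center ℂ (B q) := by
  refine mem_center_of_commute q (commute_X0_of_commute_Kk hq hq2 ?_)
    (commute_Xm_pow_Xp hq hq2 hl) ((Commute.refl _).pow_left l)
    ((commute_Cc_Xm q).symm.pow_left l)
  have h := pow_mul_Kk (Xm_mul_Kk hq) l
  rwa [inv_pow, hl, inv_one, one_smul] at h

theorem Kk_pow_mem_center (hq : q ≠ 0) (hq2 : q ^ 2 ≠ 1) {l : ℕ} (hl : (q ^ 2) ^ l = 1) :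
    Kk q ^ l ∈ Subalgebra.center ℂ (B q) := by
  have hp := mul_pow_Kk (Xp_mul_Kk hq) l
  have hm := mul_pow_Kk (Xm_mul_Kk hq) l
  rw [hl, one_smul] at hp
  rw [inv_pow, hl, inv_one, one_smul] at hm
  exact mem_center_of_commute q
    (commute_X0_of_commute_Kk hq hq2 ((Commute.refl _).pow_left l)) hp.symm hm.symm
    ((commute_Cc_Kk q).symm.pow_left l)

end Relations

section NormalForm

/-- `X₊ ^ d` for `d ≥ 0` and `X₋ ^ (-d)` for `d < 0`. -/
def ladder (q : ℂ) : ℤ → B q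
  | Int.ofNat k => Xp q ^ k
  | Int.negSucc k => Xm q ^ (k + 1)

/-- The normal monomials `C^a C'₂^b K^c X_±^|d|`. -/
def normalMonomial (q : ℂ) (i : (Fin 3 →₀ ℕ) × ℤ) : B q :=
  Cc q ^ i.1 0 * C2 q ^ i.1 1 * Kk q ^ i.1 2 * ladder q i.2

variable {q : ℂ}

theorem ladder_mul_Kk (hq : q ≠ 0) (d : ℤ) :
    ladder q d * Kk q = ((q ^ 2) ^ d) • (Kk q * ladder q d) := by
  cases d with
  | ofNat k => simpa [ladder] using pow_mul_Kk (Xp_mul_Kk hq) k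
  | negSucc k =>
    rw [zpow_negSucc, ← inv_pow]
    exact pow_mul_Kk (Xm_mul_Kk hq) (k + 1)

theorem Cc_mul_normalMonomial (i : (Fin 3 →₀ ℕ) × ℤ) :
    Cc q * normalMonomial q i = normalMonomial q (i.1 + Finsupp.single 0 1, i.2) := by
  simp [normalMonomial, pow_succ', mul_assoc]

theorem C2_mul_normalMonomial (i : (Fin 3 →₀ ℕ) × ℤ) :
    C2 q * normalMonomial q i = normalMonomial q (i.1 + Finsupp.single 1 1, i.2) := by
  have h := ((commute_Cc_C2 (q := q)).pow_left (i.1 0)).eq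
  simp only [normalMonomial, ← mul_assoc, ← h]
  simp [pow_succ', mul_assoc]

theorem Kk_mul_normalMonomial (hq : q ≠ 0) (i : (Fin 3 →₀ ℕ) × ℤ) :
    Kk q * normalMonomial q i = normalMonomial q (i.1 + Finsupp.single 2 1, i.2) := by
  have h := (((commute_Cc_Kk q).pow_left (i.1 0)).mul_left
    ((commute_Kk_C2 hq).symm.pow_left (i.1 1))).eq
  simp only [normalMonomial, ← mul_assoc]
  rw [mul_assoc (Kk q), ← h]
  simp [pow_succ', mul_assoc]

theorem normalMonomial_mul_Kk (hq : q ≠ 0) (i : (Fin 3 →₀ ℕ) × ℤ) :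
    normalMonomial q i * Kk q = ((q ^ 2) ^ i.2) • (Kk q * normalMonomial q i) := by
  have h := ((((commute_Cc_Kk q).pow_left (i.1 0)).mul_left
    ((commute_Kk_C2 hq).symm.pow_left (i.1 1))).mul_left ((Commute.refl _).pow_left (i.1 2))).eq
  rw [normalMonomial, mul_assoc, ladder_mul_Kk hq, mul_smul_comm, ← mul_assoc, h, mul_assoc]

theorem Xp_mul_normalMonomial (hq : q ≠ 0) (i : (Fin 3 →₀ ℕ) × ℤ) :
    Xp q * normalMonomial q i = ((q ^ 2) ^ i.1 2) •
      (Cc q ^ i.1 0 * C2 q ^ i.1 1 * Kk q ^ i.1 2 * (Xp q * ladder q i.2)) := by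
  have h := (((commute_Cc_Xp q).pow_left (i.1 0)).mul_left
    ((commute_Xp_C2 hq).symm.pow_left (i.1 1))).eq
  simp only [normalMonomial, ← mul_assoc]
  rw [mul_assoc (Xp q), ← h, mul_assoc _ (Xp q), mul_pow_Kk (Xp_mul_Kk hq)]
  simp only [mul_smul_comm, smul_mul_assoc, mul_assoc]

theorem Xm_mul_normalMonomial (hq : q ≠ 0) (i : (Fin 3 →₀ ℕ) × ℤ) :
    Xm q * normalMonomial q i = (((q ^ 2)⁻¹) ^ i.1 2) •
      (Cc q ^ i.1 0 * C2 q ^ i.1 1 * Kk q ^ i.1 2 * (Xm q * ladder q i.2)) := by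
  have h := (((commute_Cc_Xm q).pow_left (i.1 0)).mul_left
    ((commute_Xm_C2 hq).symm.pow_left (i.1 1))).eq
  simp only [normalMonomial, ← mul_assoc]
  rw [mul_assoc (Xm q), ← h, mul_assoc _ (Xm q), mul_pow_Kk (Xm_mul_Kk hq)]
  simp only [mul_smul_comm, smul_mul_assoc, mul_assoc]

theorem Xp_mul_ladder (hq : q ≠ 0) (hq2 : q ^ 2 ≠ 1) (d : ℤ) :
    Xp q * ladder q d = ladder q (d + 1) ∨
      Xp q * ladder q d = quadK q (q ^ 2) * ladder q (d + 1) := by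
  rcases d with k | k
  · left; exact (pow_succ' _ _).symm
  · right
    rw [← Xp_mul_Xm_eq_quadK hq hq2, mul_assoc]
    congr 1
    cases k with
    | zero => simp [ladder, Int.negSucc_eq]
    | succ k =>
      rw [show Int.negSucc (k + 1) + 1 = Int.negSucc k by omega]
      exact pow_succ' _ _

theorem Xm_mul_ladder (hq : q ≠ 0) (hq2 : q ^ 2 ≠ 1) (d : ℤ) :
    Xm q * ladder q d = ladder q (d - 1) ∨
      Xm q * ladder q d = quadK q 1 * ladder q (d - 1) := by
  rcases d with k | k
  · cases k with
    | zero =>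
      left
      rw [show Int.ofNat 0 - 1 = Int.negSucc 0 from rfl]
      simp [ladder]
    | succ k =>
      right
      rw [← Xm_mul_Xp_eq_quadK hq hq2, mul_assoc,
        show Int.ofNat (k + 1) - 1 = Int.ofNat k by simp]
      congr 1
      exact pow_succ' _ _
  · left
    rw [show Int.negSucc k - 1 = Int.negSucc (k + 1) by omega]
    exact (pow_succ' _ _).symm

theorem mul_mem_span_of_forall {y : B q} (h : ∀ i, y * normalMonomial q i ∈
      Submodule.span ℂ (Set.range (normalMonomial q))) {x : B q}
    (hx : x ∈ Submodule.span ℂ (Set.range (normalMonomial q))) :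
    y * x ∈ Submodule.span ℂ (Set.range (normalMonomial q)) := by
  have : Submodule.span ℂ (Set.range (normalMonomial q)) ≤
      (Submodule.span ℂ (Set.range (normalMonomial q))).comap (LinearMap.mulLeft ℂ y) := by
    rw [Submodule.span_le]
    rintro _ ⟨i, rfl⟩
    exact h i
  exact this hx

/-- The subalgebra of elements whose left multiplication preserves the span of the normal
monomials. -/
def spanStabilizer (q : ℂ) : Subalgebra ℂ (B q) where
  carrier := {y | ∀ x ∈ Submodule.span ℂ (Set.range (normalMonomial q)),
    y * x ∈ Submodule.span ℂ (Set.range (normalMonomial q))}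
  mul_mem' ha hb x hx := by rw [mul_assoc]; exact ha _ (hb _ hx)
  add_mem' ha hb x hx := by rw [add_mul]; exact add_mem (ha _ hx) (hb _ hx)
  algebraMap_mem' r x hx := by
    rw [Algebra.algebraMap_eq_smul_one, smul_mul_assoc, one_mul]
    exact Submodule.smul_mem _ _ hx

theorem Cc_mem_spanStabilizer : Cc q ∈ spanStabilizer q := fun _ =>
  mul_mem_span_of_forall fun i => Submodule.subset_span ⟨_, (Cc_mul_normalMonomial i).symm⟩

theorem C2_mem_spanStabilizer : C2 q ∈ spanStabilizer q := fun _ =>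
  mul_mem_span_of_forall fun i => Submodule.subset_span ⟨_, (C2_mul_normalMonomial i).symm⟩

theorem Kk_mem_spanStabilizer (hq : q ≠ 0) : Kk q ∈ spanStabilizer q := fun _ =>
  mul_mem_span_of_forall fun i => Submodule.subset_span ⟨_, (Kk_mul_normalMonomial hq i).symm⟩

theorem quadK_mem_spanStabilizer (hq : q ≠ 0) (s : ℂ) : quadK q s ∈ spanStabilizer q := by
  have hC := Cc_mem_spanStabilizer (q := q)
  have hK := Kk_mem_spanStabilizer hq
  exact sub_mem C2_mem_spanStabilizer (Subalgebra.smul_mem _ (add_mem (sub_mem (pow_mem hC 2)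
    (Subalgebra.smul_mem _ (mul_mem hC hK) _)) (Subalgebra.smul_mem _ (pow_mem hK 2) _)) _)

theorem commute_quadK (hq : q ≠ 0) (s : ℂ) (i : Fin 3 →₀ ℕ) :
    Cc q ^ i 0 * C2 q ^ i 1 * Kk q ^ i 2 * quadK q s =
      quadK q s * (Cc q ^ i 0 * C2 q ^ i 1 * Kk q ^ i 2) := by
  have h : (Cc q ^ i 0 * C2 q ^ i 1 * Kk q ^ i 2) * Kk q =
      (1 : ℂ) • (Kk q * (Cc q ^ i 0 * C2 q ^ i 1 * Kk q ^ i 2)) := by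
    rw [one_smul]
    exact ((((commute_Cc_Kk q).pow_left _).mul_left
      ((commute_Kk_C2 hq).symm.pow_left _)).mul_left ((Commute.refl _).pow_left _)).eq
  simpa using mul_quadK hq h s

theorem Xp_mem_spanStabilizer (hq : q ≠ 0) (hq2 : q ^ 2 ≠ 1) : Xp q ∈ spanStabilizer q := by
  refine fun _ => mul_mem_span_of_forall fun i => ?_
  rw [Xp_mul_normalMonomial hq]
  refine Submodule.smul_mem _ _ ?_
  rcases Xp_mul_ladder hq hq2 i.2 with h | h
  · rw [h]
    exact Submodule.subset_span ⟨(i.1, i.2 + 1), rfl⟩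
  · rw [h, ← mul_assoc, commute_quadK hq, mul_assoc]
    exact quadK_mem_spanStabilizer hq _ _ (Submodule.subset_span ⟨(i.1, i.2 + 1), rfl⟩)

theorem Xm_mem_spanStabilizer (hq : q ≠ 0) (hq2 : q ^ 2 ≠ 1) : Xm q ∈ spanStabilizer q := by
  refine fun _ => mul_mem_span_of_forall fun i => ?_
  rw [Xm_mul_normalMonomial hq]
  refine Submodule.smul_mem _ _ ?_
  rcases Xm_mul_ladder hq hq2 i.2 with h | h
  · rw [h]
    exact Submodule.subset_span ⟨(i.1, i.2 - 1), rfl⟩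
  · rw [h, ← mul_assoc, commute_quadK hq, mul_assoc]
    exact quadK_mem_spanStabilizer hq _ _ (Submodule.subset_span ⟨(i.1, i.2 - 1), rfl⟩)

theorem mem_span_normalMonomial (hq : q ≠ 0) (hq2 : q ^ 2 ≠ 1) (x : B q) :
    x ∈ Submodule.span ℂ (Set.range (normalMonomial q)) := by
  have h0 : X0 q ∈ spanStabilizer q := by
    rw [X0_eq hq hq2]
    exact Subalgebra.smul_mem _ (sub_mem Cc_mem_spanStabilizer (Kk_mem_spanStabilizer hq)) _
  have h := eq_top_of_generators_mem q (spanStabilizer q) h0 (Xp_mem_spanStabilizer hq hq2)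
    (Xm_mem_spanStabilizer hq hq2) Cc_mem_spanStabilizer x
  have h1 : (1 : B q) ∈ Submodule.span ℂ (Set.range (normalMonomial q)) :=
    Submodule.subset_span ⟨(0, Int.ofNat 0), by simp [normalMonomial, ladder]⟩
  simpa using h 1 h1

end NormalForm

section Representation

open MvPolynomial

/-- The eigenvalue of `X₀` on the `n`-th rung of the ladder representation, a polynomial in
`C = X 0`, `C'₂ = X 1`, `K = X 2`. -/
def rung (q : ℂ) (n : ℤ) : MvPolynomial (Fin 3) ℂ :=
  (q - q⁻¹)⁻¹ • (X 0 - ((q ^ 2) ^ (-n)) • X 2)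

/-- The eigenvalue of `X₋X₊` on the `n`-th rung of the ladder representation. -/
def rungProd (q : ℂ) (n : ℤ) : MvPolynomial (Fin 3) ℂ :=
  X 1 - q⁻¹ • (X 0 * rung q n) - (q⁻¹ ^ 2) • rung q n ^ 2

variable {q : ℂ}

theorem rung_pred (hq : q ≠ 0) (hq2 : q ^ 2 ≠ 1) (n : ℤ) :
    rung q (n - 1) = (q ^ 2) • rung q n - q • X 0 := by
  have hl' : q ^ 2 - 1 ≠ 0 := sub_ne_zero.mpr hq2
  have h : (q ^ 2) ^ (-(n - 1)) = q ^ 2 * (q ^ 2) ^ (-n) := by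
    rw [← zpow_one_add₀ (pow_ne_zero 2 hq)]
    congr 1
    ring
  rw [rung, rung, h]
  match_scalars <;> field_simp <;> ring

theorem rungProd_pred (hq : q ≠ 0) (hq2 : q ^ 2 ≠ 1) (n : ℤ) :
    rungProd q (n - 1) = rungProd q n + (q + q⁻¹) • ((X 0 - (q - q⁻¹) • rung q n) * rung q n) := by
  have hC : (C q : MvPolynomial (Fin 3) ℂ) * C q⁻¹ = 1 := by
    rw [← C_mul, mul_inv_cancel₀ hq, C_1]
  rw [rungProd, rungProd, rung_pred hq hq2]
  simp only [smul_eq_C_mul, C_add, C_sub, C_pow]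
  generalize (C q : MvPolynomial (Fin 3) ℂ) = a at *
  generalize (C q⁻¹ : MvPolynomial (Fin 3) ℂ) = b at *
  generalize rung q n = e
  linear_combination (a * X 0 * e * (2 * a * b + 1) - a ^ 2 * e ^ 2 * (1 + a * b)
    - a * b * X 0 ^ 2) * hC

theorem rungProd_ne_zero (n : ℤ) : rungProd q n ≠ 0 := by
  intro h
  have := congrArg (aeval ![(0 : ℂ), 1, 0]) h
  simp [rungProd, rung] at this

/-- The ladder representation of `B` on sequences of polynomials. -/
def ladderRep (hq : q ≠ 0) (hq2 : q ^ 2 ≠ 1) :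
    B q →ₐ[ℂ] Module.End ℂ (ℤ → MvPolynomial (Fin 3) ℂ) :=
  RingQuot.liftAlgHom ℂ ⟨FreeAlgebra.lift ℂ
    ![LinearMap.mulLeft ℂ (rung q), LinearMap.funLeft ℂ _ (fun n => n - 1),
      LinearMap.mulLeft ℂ (rungProd q) ∘ₗ LinearMap.funLeft ℂ _ (fun n => n + 1),
      LinearMap.mulLeft ℂ (fun _ => X 0)], by
    intro x y h
    have hr := rung_pred hq hq2
    have hr' : ∀ n, (q⁻¹ ^ 2) • rung q n - rung q (n + 1) = -(q⁻¹ • X 0) := by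
      intro n
      have := hr (n + 1)
      rw [add_sub_cancel_right] at this
      rw [this]
      match_scalars <;> field_simp <;> ring
    cases h <;> refine LinearMap.ext fun φ => funext fun n => ?_ <;>
      simp [gX0, gXp, gXm, gC, LinearMap.funLeft_apply]
    · rw [hr]
      simp only [smul_eq_C_mul]
      ring
    · have h := hr' n
      simp only [smul_eq_C_mul, inv_pow] at h ⊢
      linear_combination (rungProd q n * φ (n + 1)) * h
    · rw [rungProd_pred hq hq2]
      simp only [smul_eq_C_mul]
      ring
    all_goals ring⟩

section

variable (hq : q ≠ 0) (hq2 : q ^ 2 ≠ 1) (φ : ℤ → MvPolynomial (Fin 3) ℂ) (n : ℤ)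

theorem ladderRep_X0 : ladderRep hq hq2 (X0 q) φ n = rung q n * φ n := by
  simp [ladderRep, X0, gX0]

theorem ladderRep_Xp : ladderRep hq hq2 (Xp q) φ n = φ (n - 1) := by
  simp [ladderRep, Xp, gXp, LinearMap.funLeft_apply]

theorem ladderRep_Xm : ladderRep hq hq2 (Xm q) φ n = rungProd q n * φ (n + 1) := by
  simp [ladderRep, Xm, gXm, LinearMap.funLeft_apply]

theorem ladderRep_Cc : ladderRep hq hq2 (Cc q) φ n = X 0 * φ n := by
  simp [ladderRep, Cc, gC]

theorem ladderRep_C2 : ladderRep hq hq2 (C2 q) φ n = X 1 * φ n := by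
  simp only [C2, map_add, map_mul, map_smul, map_pow, pow_two (ladderRep hq hq2 (X0 q)),
    LinearMap.add_apply, LinearMap.smul_apply, Module.End.mul_apply, Pi.add_apply, Pi.smul_apply,
    ladderRep_X0, ladderRep_Xp, ladderRep_Xm, ladderRep_Cc, rungProd, add_sub_cancel_right,
    smul_eq_C_mul]
  ring

theorem ladderRep_Kk : ladderRep hq hq2 (Kk q) φ n = ((q ^ 2) ^ (-n)) • (X 2 * φ n) := by
  simp only [Kk, map_sub, map_smul, LinearMap.sub_apply, LinearMap.smul_apply, Pi.sub_apply,
    Pi.smul_apply, ladderRep_X0, ladderRep_Cc, rung, smul_mul_assoc, smul_smul,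
    mul_inv_cancel₀ (sub_inv_ne_zero hq hq2), one_smul, sub_mul, sub_sub_cancel]

theorem ladderRep_Cc_pow (k : ℕ) : ladderRep hq hq2 (Cc q ^ k) φ n = X 0 ^ k * φ n := by
  induction k with
  | zero => simp
  | succ k ih =>
    rw [pow_succ', map_mul, Module.End.mul_apply, ladderRep_Cc, ih, pow_succ', mul_assoc]

theorem ladderRep_C2_pow (k : ℕ) : ladderRep hq hq2 (C2 q ^ k) φ n = X 1 ^ k * φ n := by
  induction k with
  | zero => simp
  | succ k ih =>
    rw [pow_succ', map_mul, Module.End.mul_apply, ladderRep_C2, ih, pow_succ', mul_assoc]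

theorem ladderRep_Kk_pow (k : ℕ) :
    ladderRep hq hq2 (Kk q ^ k) φ n = ((q ^ 2) ^ (-n)) ^ k • (X 2 ^ k * φ n) := by
  induction k with
  | zero => simp
  | succ k ih =>
    rw [pow_succ', map_mul, Module.End.mul_apply, ladderRep_Kk, ih, pow_succ' (_ ^ _),
      pow_succ' (X 2), mul_smul_comm, smul_smul, mul_assoc]

end

theorem ladderRep_Xp_single (hq : q ≠ 0) (hq2 : q ^ 2 ≠ 1) (n : ℤ) (p : MvPolynomial (Fin 3) ℂ) :
    ladderRep hq hq2 (Xp q) (Pi.single n p) = Pi.single (n + 1) p := by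
  funext m
  rw [ladderRep_Xp]
  simp only [Pi.single_apply, sub_eq_iff_eq_add]

theorem ladderRep_Xm_single (hq : q ≠ 0) (hq2 : q ^ 2 ≠ 1) (n : ℤ) (p : MvPolynomial (Fin 3) ℂ) :
    ladderRep hq hq2 (Xm q) (Pi.single n p) = Pi.single (n - 1) (rungProd q (n - 1) * p) := by
  funext m
  rw [ladderRep_Xm]
  simp only [Pi.single_apply, eq_sub_iff_add_eq]
  split_ifs with h
  · rw [← h, add_sub_cancel_right]
  · rw [mul_zero]

theorem exists_ladderRep_ladder (hq : q ≠ 0) (hq2 : q ^ 2 ≠ 1) (d : ℤ) :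
    ∃ p, p ≠ 0 ∧ ladderRep hq hq2 (ladder q d) (Pi.single 0 1) = Pi.single d p := by
  rcases d with k | k
  · refine ⟨1, one_ne_zero, ?_⟩
    simp only [ladder]
    induction k with
    | zero => simp
    | succ k ih =>
      rw [pow_succ', map_mul, Module.End.mul_apply, ih, ladderRep_Xp_single]
      rfl
  · simp only [ladder]
    induction k with
    | zero =>
      refine ⟨rungProd q (-1) * 1, by simpa using rungProd_ne_zero (-1), ?_⟩
      rw [zero_add, pow_one, ladderRep_Xm_single]
      rfl
    | succ k ih =>
      obtain ⟨p, hp, h⟩ := ih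
      refine ⟨rungProd q (Int.negSucc (k + 1)) * p, mul_ne_zero (rungProd_ne_zero _) hp, ?_⟩
      rw [pow_succ', map_mul, Module.End.mul_apply, h, ladderRep_Xm_single]
      rfl

theorem X_pow_mul_eq_monomial (s : Fin 3 →₀ ℕ) :
    (X 0 ^ s 0 * X 1 ^ s 1 * X 2 ^ s 2 : MvPolynomial (Fin 3) ℂ) = monomial s 1 := by
  rw [monomial_eq, Finsupp.prod_fintype _ _ (by simp), Fin.prod_univ_three, C_1, one_mul]

/-- Evaluation of the ladder representation at the generator of rung `0`. -/
def ladderEval (hq : q ≠ 0) (hq2 : q ^ 2 ≠ 1) : B q →ₗ[ℂ] (ℤ → MvPolynomial (Fin 3) ℂ) :=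
  LinearMap.applyₗ (Pi.single 0 1) ∘ₗ (ladderRep hq hq2).toLinearMap

theorem linearIndependent_ladderEval (hq : q ≠ 0) (hq2 : q ^ 2 ≠ 1) :
    LinearIndependent ℂ (ladderEval hq hq2 ∘ normalMonomial q) := by
  choose p hp hpd using exists_ladderRep_ladder hq hq2
  rw [linearIndependent_iff']
  intro s g hg i hi
  have key : ∀ j : (Fin 3 →₀ ℕ) × ℤ, (ladderEval hq hq2 ∘ normalMonomial q) j i.2 =
      (if j.2 = i.2 then monomial j.1 (((q ^ 2) ^ (-i.2)) ^ j.1 2) else 0) * p i.2 := by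
    intro j
    simp only [ladderEval, normalMonomial, Function.comp_apply, LinearMap.comp_apply,
      AlgHom.toLinearMap_apply, LinearMap.applyₗ_apply_apply, map_mul, Module.End.mul_apply, hpd,
      ladderRep_Cc_pow, ladderRep_C2_pow, ladderRep_Kk_pow, Pi.single_apply, eq_comm (a := i.2)]
    split_ifs with h
    · have hm : monomial j.1 (((q ^ 2) ^ (-i.2)) ^ j.1 2) =
          (((q ^ 2) ^ (-i.2)) ^ j.1 2) • monomial j.1 1 := by
        rw [smul_monomial, smul_eq_mul, mul_one]
      rw [hm, ← X_pow_mul_eq_monomial, h]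
      simp only [mul_smul_comm, smul_mul_assoc, mul_assoc]
    · simp
  have h := congrFun hg i.2
  simp only [Finset.sum_apply, Pi.smul_apply, key, Pi.zero_apply, ← smul_mul_assoc,
    ← Finset.sum_mul] at h
  have h2 := congrArg (coeff i.1) ((mul_eq_zero.mp h).resolve_right (hp _))
  rw [coeff_sum, Finset.sum_eq_single i] at h2
  · simpa [zpow_ne_zero _ (pow_ne_zero 2 hq)] using h2
  · intro j _ hj
    by_cases h3 : j.2 = i.2
    · have h4 : j.1 ≠ i.1 := fun h4 => hj (Prod.ext h4 h3)
      simp [h3, coeff_monomial, h4]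
    · simp [h3]
  · exact fun h => absurd hi h

theorem linearIndependent_normalMonomial (hq : q ≠ 0) (hq2 : q ^ 2 ≠ 1) :
    LinearIndependent ℂ (normalMonomial q) :=
  (linearIndependent_ladderEval hq hq2).of_comp

theorem eq_zero_of_ladderRep_apply_eq_zero (hq : q ≠ 0) (hq2 : q ^ 2 ≠ 1) {y : B q}
    (h : ladderRep hq hq2 y (Pi.single 0 1) = 0) : y = 0 := by
  obtain ⟨c, rfl⟩ := (Finsupp.mem_span_range_iff_exists_finsupp).mp
    (mem_span_normalMonomial hq hq2 y)
  have h2 : ladderEval hq hq2 (Finsupp.linearCombination ℂ (normalMonomial q) c) = 0 := h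
  rw [Finsupp.apply_linearCombination] at h2
  rw [linearIndependent_iff.mp (linearIndependent_ladderEval hq hq2) c h2]
  simp

theorem eq_zero_of_Kk_mul_eq_zero (hq : q ≠ 0) (hq2 : q ^ 2 ≠ 1) {y : B q}
    (h : Kk q * y = 0) : y = 0 := by
  refine eq_zero_of_ladderRep_apply_eq_zero hq hq2 (funext fun n => ?_)
  have h2 := congrFun (LinearMap.congr_fun (congrArg (ladderRep hq hq2) h) (Pi.single 0 1)) n
  rw [map_mul, Module.End.mul_apply, ladderRep_Kk, map_zero] at h2
  simpa [zpow_ne_zero _ (pow_ne_zero 2 hq)] using h2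

theorem eq_zero_of_mul_Xp_eq_zero (hq : q ≠ 0) (hq2 : q ^ 2 ≠ 1) {y : B q}
    (h : y * Xp q = 0) : y = 0 := by
  refine eq_zero_of_ladderRep_apply_eq_zero hq hq2 ?_
  have h2 := LinearMap.congr_fun (congrArg (ladderRep hq hq2) h) (Pi.single (-1) 1)
  rwa [map_mul, Module.End.mul_apply, ladderRep_Xp_single, map_zero] at h2

end Representation

section Center

variable {q : ℂ}

theorem commute_ladder_Xp (hq : q ≠ 0) (hq2 : q ^ 2 ≠ 1) {d : ℤ} (hd : (q ^ 2) ^ d = 1) :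
    Commute (ladder q d) (Xp q) := by
  rcases d with k | k
  · exact (Commute.refl _).pow_left k
  · rw [zpow_negSucc, inv_eq_one] at hd
    exact commute_Xm_pow_Xp hq hq2 hd

/-- A central element only involves normal monomials of `K`-degree and ladder degree at which
`q²` has trivial power. -/
theorem exponents_of_mem_center (hq : q ≠ 0) (hq2 : q ^ 2 ≠ 1)
    {c : (Fin 3 →₀ ℕ) × ℤ →₀ ℂ}
    (hc : (c.sum fun i a => a • normalMonomial q i) ∈ Subalgebra.center ℂ (B q))
    {i : (Fin 3 →₀ ℕ) × ℤ} (hi : i ∈ c.support) :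
    (q ^ 2) ^ i.2 = 1 ∧ (q ^ 2) ^ i.1 2 = 1 := by
  have hli := linearIndependent_iff'.mp (linearIndependent_normalMonomial hq hq2) c.support
  rw [Subalgebra.mem_center_iff] at hc
  simp only [Finsupp.sum, Finset.mul_sum, Finset.sum_mul] at hc
  have hd : ∀ j ∈ c.support, (q ^ 2) ^ j.2 = 1 := by
    intro j hj
    have h : Kk q * ∑ j ∈ c.support, (c j * (1 - (q ^ 2) ^ j.2)) • normalMonomial q j = 0 := by
      rw [← sub_eq_zero.mpr (hc (Kk q)), ← Finset.sum_sub_distrib, Finset.mul_sum]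
      refine Finset.sum_congr rfl fun j _ => ?_
      rw [mul_smul_comm, mul_smul_comm, smul_mul_assoc, normalMonomial_mul_Kk hq]
      module
    have h2 := hli _ (eq_zero_of_Kk_mul_eq_zero hq hq2 h) j hj
    exact (sub_eq_zero.mp ((mul_eq_zero.mp h2).resolve_left (Finsupp.mem_support_iff.mp hj))).symm
  refine ⟨hd i hi, ?_⟩
  have h : (∑ j ∈ c.support, (c j * ((q ^ 2) ^ j.1 2 - 1)) • normalMonomial q j) * Xp q = 0 := by
    rw [← sub_eq_zero.mpr (hc (Xp q)), ← Finset.sum_sub_distrib, Finset.sum_mul]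
    refine Finset.sum_congr rfl fun j hj => ?_
    rw [mul_smul_comm, smul_mul_assoc, smul_mul_assoc, Xp_mul_normalMonomial hq,
      ← (commute_ladder_Xp hq hq2 (hd j hj)).eq, ← mul_assoc, ← normalMonomial]
    module
  have h2 := hli _ (eq_zero_of_mul_Xp_eq_zero hq hq2 h) i hi
  exact sub_eq_zero.mp ((mul_eq_zero.mp h2).resolve_left (Finsupp.mem_support_iff.mp hi))

theorem normalMonomial_mem_of_dvd {S : Subalgebra ℂ (B q)} {l : ℕ} (hC : Cc q ∈ S)
    (hC2 : C2 q ∈ S) (hK : Kk q ^ l ∈ S) {i : (Fin 3 →₀ ℕ) × ℤ} (hi : l ∣ i.1 2)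
    (hd : ladder q i.2 ∈ S) : normalMonomial q i ∈ S := by
  obtain ⟨k, hk⟩ := hi
  refine mul_mem (mul_mem (mul_mem (pow_mem hC _) (pow_mem hC2 _)) ?_) hd
  rw [hk, pow_mul]
  exact pow_mem hK k

end Center

/-- at a root of unity (l ≥ 2 minimal with q^{2l} = 1), the centre
of B is the ℂ-subspace A₊ + A₋, where A₊ (resp. A₋) is the unital subalgebra
generated by C, C'₂, X₊^l (resp. X₋^l) and (C−λX₀)^l. -/
theorem center_root_of_unity (q : ℂ) (hq : q ≠ 0) (hq2 : q ^ 2 ≠ 1)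
    (l : ℕ) (hl : 2 ≤ l) (hq2l : q ^ (2 * l) = 1)
    (hmin : ∀ m : ℕ, 0 < m → m < l → q ^ (2 * m) ≠ 1) :
    Subalgebra.toSubmodule (Subalgebra.center ℂ (B q)) =
      Subalgebra.toSubmodule
          (Algebra.adjoin ℂ {Cc q, C2 q, Xp q ^ l, (Cc q - (q - q⁻¹) • X0 q) ^ l})
      + Subalgebra.toSubmodule
          (Algebra.adjoin ℂ {Cc q, C2 q, Xm q ^ l, (Cc q - (q - q⁻¹) • X0 q) ^ l}) := by
  have hprim : IsPrimitiveRoot (q ^ 2) l :=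
    IsPrimitiveRoot.mk_of_lt _ (by omega) (by rw [← pow_mul, hq2l]) fun m h0 hm => by
      rw [← pow_mul]; exact hmin m h0 hm
  have hl1 := hprim.pow_eq_one
  rw [Submodule.add_eq_sup]
  change _ = Subalgebra.toSubmodule (Algebra.adjoin ℂ {Cc q, C2 q, Xp q ^ l, Kk q ^ l}) ⊔
    Subalgebra.toSubmodule (Algebra.adjoin ℂ {Cc q, C2 q, Xm q ^ l, Kk q ^ l})
  apply le_antisymm
  · intro z hz
    obtain ⟨c, rfl⟩ := Finsupp.mem_span_range_iff_exists_finsupp.mp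
      (mem_span_normalMonomial hq hq2 z)
    refine Submodule.sum_mem _ fun i hi => Submodule.smul_mem _ _ ?_
    obtain ⟨hd, hk⟩ := exponents_of_mem_center hq hq2 hz hi
    rw [hprim.zpow_eq_one_iff_dvd] at hd
    rw [hprim.pow_eq_one_iff_dvd] at hk
    obtain ⟨s, d⟩ := i
    rcases d with k | k
    · refine Submodule.mem_sup_left (normalMonomial_mem_of_dvd
        (Algebra.subset_adjoin (by simp)) (Algebra.subset_adjoin (by simp))
        (Algebra.subset_adjoin (by simp)) hk ?_)
      obtain ⟨j, rfl⟩ := Int.natCast_dvd_natCast.mp hd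
      rw [ladder, pow_mul]
      exact pow_mem (Algebra.subset_adjoin (by simp)) j
    · refine Submodule.mem_sup_right (normalMonomial_mem_of_dvd
        (Algebra.subset_adjoin (by simp)) (Algebra.subset_adjoin (by simp))
        (Algebra.subset_adjoin (by simp)) hk ?_)
      obtain ⟨j, hj⟩ := Int.natCast_dvd_natCast.mp (Int.dvd_negSucc.mp hd)
      rw [ladder, hj, pow_mul]
      exact pow_mem (Algebra.subset_adjoin (by simp)) j
  · have hK := Kk_pow_mem_center hq hq2 hl1
    refine sup_le (Algebra.adjoin_le ?_) (Algebra.adjoin_le ?_)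
    · rintro _ (rfl | rfl | rfl | rfl)
      exacts [Cc_mem_center, C2_mem_center hq, Xp_pow_mem_center hq hq2 hl1, hK]
    · rintro _ (rfl | rfl | rfl | rfl)
      exacts [Cc_mem_center, C2_mem_center hq, Xm_pow_mem_center hq hq2 hl1, hK]

end SL2q
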